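/- arXiv:2009.13256 — 2 statements merged into one kernel-verified Lean document; each statement's English description precedes it below -/
import Mathlib

section
/- Let g : [0, ∞) → ℝ be a function for which there exist constants c₁, c₂ ≥ 0 such that |g(b) − g(a)| ≤ c₁·(b − a) + c₂ for all 0 ≤ a ≤ b. Set I_L = liminf_{l→∞} g(l)/l and I_U = limsup_{l→∞} g(l)/l. Then for every v ∈ [I_L, I_U] and every real u > 0 there exists a strictly increasing sequence of positive integers (m_k) with m_k → ∞ such that lim_{k→∞} g(u·m_k)/(u·m_k) = v. -/
open Filter Topology

/-- A real sequence with vanishing increments that is frequently below every `c > v` and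
frequently above every `c < v` has `v` as a cluster point. -/
lemma mapClusterPt_of_tendsto_sub_zero {a : ℕ → ℝ} {v : ℝ}
    (ha : Tendsto (fun n => a (n + 1) - a n) atTop (𝓝 0))
    (hlow : ∀ c > v, ∃ᶠ n in atTop, a n < c) (hup : ∀ c < v, ∃ᶠ n in atTop, c < a n) :
    MapClusterPt v atTop a := by
  rw [(Metric.nhds_basis_ball (x := v)).mapClusterPt_iff_frequently]
  intro ε hε
  by_contra hfar
  rw [not_frequently] at hfar
  have hstep : ∀ᶠ n in atTop, |a (n + 1) - a n| < ε := by
    simpa [Real.dist_eq] using (Metric.tendsto_nhds.1 ha) ε hε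
  obtain ⟨N, hN⟩ := eventually_atTop.1 (hfar.and hstep)
  simp only [Metric.mem_ball, Real.dist_eq, not_lt] at hN
  obtain ⟨n, hn, han⟩ := frequently_atTop.1 (hlow (v + ε) (by linarith)) N
  have hstay : ∀ m ≥ n, a m ≤ v - ε := by
    intro m hm
    induction m, hm using Nat.le_induction with
    | base =>
      rcases le_abs'.1 (hN n hn).1 with h | h <;> linarith
    | succ m hm ih =>
      have h₁ := (abs_lt.1 (hN m (hn.trans hm)).2).2
      rcases le_abs'.1 (hN (m + 1) (by omega)).1 with h | h <;> linarith
  obtain ⟨m, hm, ham⟩ := frequently_atTop.1 (hup (v - ε) (by linarith)) n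
  exact absurd (hstay m hm) (not_le.2 ham)

section CoarseLipschitz

variable {g : ℝ → ℝ} {c₁ c₂ : ℝ}

lemma abs_div_self_le_of_coarse_lipschitz (hc₂ : 0 ≤ c₂)
    (hg : ∀ a b : ℝ, 0 ≤ a → a ≤ b → |g b - g a| ≤ c₁ * (b - a) + c₂) {l : ℝ} (hl : 1 ≤ l) :
    |g l / l| ≤ c₁ + c₂ + |g 0| := by
  have hl₀ : 0 < l := by linarith
  rw [abs_div, abs_of_pos hl₀, div_le_iff₀ hl₀]
  have h := hg 0 l le_rfl hl₀.le
  have h' := abs_sub_abs_le_abs_sub (g l) (g 0)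
  nlinarith [abs_nonneg (g 0)]

lemma abs_div_self_sub_div_self_le_of_coarse_lipschitz (hc₁ : 0 ≤ c₁) (hc₂ : 0 ≤ c₂)
    (hg : ∀ a b : ℝ, 0 ≤ a → a ≤ b → |g b - g a| ≤ c₁ * (b - a) + c₂)
    {u a b : ℝ} (ha : 1 ≤ a) (hab : a ≤ b) (hb : b ≤ a + u) :
    |g b / b - g a / a| ≤ (c₁ * u + c₂ + (c₁ + c₂ + |g 0|) * u) / b := by
  have ha₀ : 0 < a := by linarith
  have hb₀ : 0 < b := by linarith
  have key : g b / b - g a / a = ((g b - g a) - g a / a * (b - a)) / b := by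
    field_simp
    ring
  rw [key, abs_div, abs_of_pos hb₀]
  gcongr
  refine (abs_sub _ _).trans (add_le_add ((hg a b ha₀.le hab).trans ?_) ?_)
  · gcongr
    linarith
  · rw [abs_mul, abs_of_nonneg (sub_nonneg.2 hab)]
    have hM := abs_div_self_le_of_coarse_lipschitz hc₂ hg ha
    exact mul_le_mul hM (by linarith) (by linarith) ((abs_nonneg _).trans hM)

/-- Moving the argument of `l ↦ g l / l` back by at most `u` changes its value by `o(1)`. -/
lemma tendsto_div_self_sub_div_self_of_coarse_lipschitz (hc₁ : 0 ≤ c₁) (hc₂ : 0 ≤ c₂)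
    (hg : ∀ a b : ℝ, 0 ≤ a → a ≤ b → |g b - g a| ≤ c₁ * (b - a) + c₂) (u : ℝ)
    {ι : Type*} {F : Filter ι} {p q : ι → ℝ} (hq : Tendsto q F atTop)
    (hpq : ∀ᶠ i in F, p i ≤ q i) (hqp : ∀ᶠ i in F, q i ≤ p i + u) :
    Tendsto (fun i => g (q i) / q i - g (p i) / p i) F (𝓝 0) := by
  refine squeeze_zero_norm' ?_
    (hq.const_div_atTop (c₁ * u + c₂ + (c₁ + c₂ + |g 0|) * u))
  filter_upwards [hq.eventually_ge_atTop (1 + u), hpq, hqp] with i h₁ h₂ h₃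
  exact abs_div_self_sub_div_self_le_of_coarse_lipschitz hc₁ hc₂ hg (by linarith) h₂ h₃

end CoarseLipschitz

/-- If `g : [0,∞) → ℝ` satisfies `|g b - g a| ≤ c₁ (b - a) + c₂` for all `0 ≤ a ≤ b`, then
every value `v` between `I_L = liminf g(l)/l` and `I_U = limsup g(l)/l` is attained as the
limit of `g(u m_k)/(u m_k)` along a strictly increasing sequence of positive integers
`m_k → ∞`, for any `u > 0`. -/
theorem mean_index_interval (g : ℝ → ℝ) (c₁ c₂ : ℝ) (hc₁ : 0 ≤ c₁) (hc₂ : 0 ≤ c₂)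
    (hg : ∀ a b : ℝ, 0 ≤ a → a ≤ b → |g b - g a| ≤ c₁ * (b - a) + c₂)
    (IL IU : ℝ)
    (hIL : IL = liminf (fun l : ℝ => g l / l) atTop)
    (hIU : IU = limsup (fun l : ℝ => g l / l) atTop)
    (v : ℝ) (hv : v ∈ Set.Icc IL IU) (u : ℝ) (hu : 0 < u) :
    ∃ m : ℕ → ℕ, StrictMono m ∧ (∀ k, 0 < m k) ∧
      Tendsto (fun k => (m k : ℝ)) atTop atTop ∧
      Tendsto (fun k => g (u * (m k : ℝ)) / (u * (m k : ℝ))) atTop (𝓝 v) := by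
  have hbdd : ∀ᶠ l : ℝ in atTop, |g l / l| ≤ c₁ + c₂ + |g 0| := by
    filter_upwards [eventually_ge_atTop 1] with l hl
    exact abs_div_self_le_of_coarse_lipschitz hc₂ hg hl
  have hle : IsBoundedUnder (· ≤ ·) atTop (fun l : ℝ => g l / l) :=
    isBoundedUnder_of_eventually_le (hbdd.mono fun l hl => (abs_le.1 hl).2)
  have hge : IsBoundedUnder (· ≥ ·) atTop (fun l : ℝ => g l / l) :=
    isBoundedUnder_of_eventually_ge (hbdd.mono fun l hl => (abs_le.1 hl).1)
  have hfloor : Tendsto (fun l : ℝ => ⌊l / u⌋₊) atTop atTop :=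
    tendsto_nat_floor_atTop.comp (tendsto_id.atTop_div_const hu)
  have hclose : Tendsto (fun l : ℝ => g l / l - g (u * ⌊l / u⌋₊) / (u * ⌊l / u⌋₊))
      atTop (𝓝 0) := by
    refine tendsto_div_self_sub_div_self_of_coarse_lipschitz hc₁ hc₂ hg u tendsto_id ?_ ?_
    · filter_upwards [eventually_ge_atTop 0] with l hl
      have h := (le_div_iff₀ hu).1 (Nat.floor_le (div_nonneg hl hu.le))
      simpa [mul_comm] using h
    · refine Eventually.of_forall fun l => ?_
      have h := (div_lt_iff₀ hu).1 (Nat.lt_floor_add_one (l / u))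
      linarith
  have hstep : Tendsto (fun n : ℕ => g (u * (n + 1 : ℕ)) / (u * (n + 1 : ℕ)) -
      g (u * n) / (u * n)) atTop (𝓝 0) := by
    refine tendsto_div_self_sub_div_self_of_coarse_lipschitz hc₁ hc₂ hg u
      ((tendsto_natCast_atTop_atTop.comp (tendsto_add_atTop_nat 1)).const_mul_atTop hu) ?_ ?_
    all_goals
      refine Eventually.of_forall fun n => ?_
      simp only [Nat.cast_add, Nat.cast_one]
      linarith
  have hcluster : MapClusterPt v atTop (fun n : ℕ => g (u * n) / (u * n)) := by
    refine mapClusterPt_of_tendsto_sub_zero hstep (fun c hc => ?_) (fun c hc => ?_)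
    · have hfreq : ∃ᶠ l : ℝ in atTop, g l / l < (v + c) / 2 :=
        frequently_lt_of_liminf_lt hle.isCoboundedUnder_ge (by linarith [hv.1])
      refine hfloor.frequently ((hfreq.and_eventually
        (hclose.eventually_const_lt (show (v - c) / 2 < 0 by linarith))).mono ?_)
      rintro l ⟨h₁, h₂⟩
      linarith
    · have hfreq : ∃ᶠ l : ℝ in atTop, (v + c) / 2 < g l / l :=
        frequently_lt_of_lt_limsup hge.isCoboundedUnder_le (by linarith [hv.2])
      refine hfloor.frequently ((hfreq.and_eventually
        (hclose.eventually_lt_const (show 0 < (v - c) / 2 by linarith))).mono ?_)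
      rintro l ⟨h₁, h₂⟩
      linarith
  obtain ⟨ψ, hψ, hlim⟩ := hcluster.tendsto_subseq
  have hm : StrictMono fun k => ψ (k + 1) := fun i j hij => hψ (Nat.add_lt_add_right hij 1)
  exact ⟨fun k => ψ (k + 1), hm, fun k => k.succ_pos.trans_le (hψ.id_le (k + 1)),
    tendsto_natCast_atTop_atTop.comp hm.tendsto_atTop, hlim.comp (tendsto_add_atTop_nat 1)⟩
end

section
/- Let X be a set, S : X → X a map, d ≥ 0 and c₀ ≥ 0 constants, and let f, g, h : X × ℕ₊ → ℝ satisfy for all x ∈ X and all positive integers n, m: (i) f(x, n+m) ≤ f(x, n) + f(Sⁿx, m); (ii) g(x, n+m) ≥ g(x, n) + g(Sⁿx, m); (iii) f(x, n) − 2d ≤ g(x, n) ≤ h(x, n) ≤ f(x, n); (iv) |f(x, 1)| ≤ c₀. Fix B ∈ X and define H_{k,n}(B) = (1/n)·Σ_{l=0}^{n−1} h(S^{2^k·l}B, 2^k), H_k(B) = limsup_{n→∞} H_{k,n}(B) and H̲_k(B) = liminf_{n→∞} H_{k,n}(B). Then the limits lim_{k→∞} H_k(B)/2^k and lim_{k→∞}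 H̲_k(B)/2^k exist, and lim_{k→∞} H_k(B)/2^k = limsup_{n→∞} f(B, n)/n while lim_{k→∞} H̲_k(B)/2^k = liminf_{n→∞} f(B, n)/n. -/
open Filter Topology

section Limsup

variable {w a : ℕ → ℝ} {C δ : ℝ}

theorem limsup_le_limsup_add_of_bounded (hw : ∀ᶠ m in atTop, |w m| ≤ C)
    (ha : ∀ᶠ m in atTop, |a m| ≤ C) (h : ∀ᶠ m in atTop, w m ≤ a m + δ) :
    limsup w atTop ≤ limsup a atTop + δ := by
  have hau : IsBoundedUnder (· ≤ ·) atTop a :=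
    isBoundedUnder_of_eventually_le (ha.mono fun m hm => (abs_le.1 hm).2)
  have hal : IsBoundedUnder (· ≥ ·) atTop a :=
    isBoundedUnder_of_eventually_ge (ha.mono fun m hm => (abs_le.1 hm).1)
  have hwl : IsBoundedUnder (· ≥ ·) atTop w :=
    isBoundedUnder_of_eventually_ge (hw.mono fun m hm => (abs_le.1 hm).1)
  have hadd : limsup (fun m => a m + δ) atTop = limsup a atTop + δ :=
    limsup_add_const atTop a δ hau hal.isCoboundedUnder_le
  rw [← hadd]
  refine limsup_le_limsup h hwl.isCoboundedUnder_le ?_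
  exact isBoundedUnder_of_eventually_le (a := C + δ)
    (ha.mono fun m hm => by linarith [(abs_le.1 hm).2])

theorem liminf_le_liminf_add_of_bounded (hw : ∀ᶠ m in atTop, |w m| ≤ C)
    (ha : ∀ᶠ m in atTop, |a m| ≤ C) (h : ∀ᶠ m in atTop, w m ≤ a m + δ) :
    liminf w atTop ≤ liminf a atTop + δ := by
  have hau : IsBoundedUnder (· ≤ ·) atTop a :=
    isBoundedUnder_of_eventually_le (ha.mono fun m hm => (abs_le.1 hm).2)
  have hal : IsBoundedUnder (· ≥ ·) atTop a :=
    isBoundedUnder_of_eventually_ge (ha.mono fun m hm => (abs_le.1 hm).1)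
  have hwl : IsBoundedUnder (· ≥ ·) atTop w :=
    isBoundedUnder_of_eventually_ge (hw.mono fun m hm => (abs_le.1 hm).1)
  have hadd : liminf (fun m => a m + δ) atTop = liminf a atTop + δ :=
    liminf_add_const atTop a δ hau.isCoboundedUnder_ge hal
  rw [← hadd]
  refine liminf_le_liminf h hwl ?_
  exact (isBoundedUnder_of_eventually_le (a := C + δ)
    (ha.mono fun m hm => by linarith [(abs_le.1 hm).2])).isCoboundedUnder_ge

theorem abs_limsup_sub_limsup_le (ha : ∀ᶠ m in atTop, |a m| ≤ C)
    (h : ∀ᶠ m in atTop, |w m - a m| ≤ δ) :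
    |limsup w atTop - limsup a atTop| ≤ δ ∧ |liminf w atTop - liminf a atTop| ≤ δ := by
  have hδ : 0 ≤ δ := by
    obtain ⟨m, hm⟩ := h.exists
    exact (abs_nonneg _).trans hm
  have hw : ∀ᶠ m in atTop, |w m| ≤ C + δ := by
    filter_upwards [ha, h] with m h₁ h₂
    rw [abs_le] at *
    constructor <;> linarith
  have ha' : ∀ᶠ m in atTop, |a m| ≤ C + δ := ha.mono fun m hm => by linarith
  have hwa : ∀ᶠ m in atTop, w m ≤ a m + δ := h.mono fun m hm => by linarith [(abs_le.1 hm).2]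
  have haw : ∀ᶠ m in atTop, a m ≤ w m + δ := h.mono fun m hm => by linarith [(abs_le.1 hm).1]
  have h₁ := limsup_le_limsup_add_of_bounded hw ha' hwa
  have h₂ := limsup_le_limsup_add_of_bounded ha' hw haw
  have h₃ := liminf_le_liminf_add_of_bounded hw ha' hwa
  have h₄ := liminf_le_liminf_add_of_bounded ha' hw haw
  constructor <;> rw [abs_le] <;> constructor <;> linarith

/-- Reindexing a sequence by `m ↦ m / N` and rescaling it by a positive constant commutes with
`limsup` and `liminf`. -/
theorem limsup_comp_div_div {u : ℕ → ℝ} {c : ℝ} {N : ℕ} (hN : 0 < N) (hc : 0 < c)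
    (hu : ∀ᶠ n in atTop, |u n| ≤ C) :
    limsup (fun m => u (m / N) / c) atTop = limsup u atTop / c ∧
      liminf (fun m => u (m / N) / c) atTop = liminf u atTop / c := by
  have hub : IsBoundedUnder (· ≤ ·) atTop u :=
    isBoundedUnder_of_eventually_le (hu.mono fun m hm => (abs_le.1 hm).2)
  have hlb : IsBoundedUnder (· ≥ ·) atTop u :=
    isBoundedUnder_of_eventually_ge (hu.mono fun m hm => (abs_le.1 hm).1)
  have hmono : Monotone fun y : ℝ => y / c := fun _ _ hxy => by
    dsimp only
    gcongr
  have hcont : Continuous fun y : ℝ => y / c := by fun_prop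
  constructor
  · rw [hmono.map_limsup_of_continuousAt u hcont.continuousAt hub hlb.isCoboundedUnder_le]
    conv_rhs => rw [← map_div_atTop_eq_nat N hN]
    rfl
  · rw [hmono.map_liminf_of_continuousAt u hcont.continuousAt hub.isCoboundedUnder_ge hlb]
    conv_rhs => rw [← map_div_atTop_eq_nat N hN]
    rfl

end Limsup

/-- Iterating subadditivity along blocks of length `N`. -/
theorem subadditive_cocycle_le_sum {X : Type*} {S : X → X} {f : X → ℕ → ℝ}
    (hf : ∀ (x : X) (n m : ℕ), 0 < n → 0 < m → f x (n + m) ≤ f x n + f (S^[n] x) m)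
    (x : X) {N n : ℕ} (hN : 0 < N) (hn : 0 < n) :
    f x (N * n) ≤ ∑ l ∈ Finset.range n, f (S^[N * l] x) N := by
  induction n, hn using Nat.le_induction with
  | base => simp
  | succ n hn ih =>
    rw [Finset.sum_range_succ, Nat.mul_succ]
    exact (hf x (N * n) N (Nat.mul_pos hN hn) hN).trans (by gcongr)

theorem superadditive_cocycle_sum_le {X : Type*} {S : X → X} {g : X → ℕ → ℝ}
    (hg : ∀ (x : X) (n m : ℕ), 0 < n → 0 < m → g x n + g (S^[n] x) m ≤ g x (n + m))
    (x : X) {N n : ℕ} (hN : 0 < N) (hn : 0 < n) :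
    ∑ l ∈ Finset.range n, g (S^[N * l] x) N ≤ g x (N * n) := by
  have := subadditive_cocycle_le_sum (S := S) (f := fun x n => -g x n)
    (fun x n m hn hm => by linarith [hg x n m hn hm]) x hN hn
  rw [Finset.sum_neg_distrib] at this
  linarith

section Cocycle

variable {X : Type*} {S : X → X} {d c₀ : ℝ} {f g h : X → ℕ → ℝ}

theorem abs_cocycle_le (hd : 0 ≤ d)
    (hf : ∀ (x : X) (n m : ℕ), 0 < n → 0 < m → f x (n + m) ≤ f x n + f (S^[n] x) m)
    (hg : ∀ (x : X) (n m : ℕ), 0 < n → 0 < m → g x n + g (S^[n] x) m ≤ g x (n + m))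
    (hfg : ∀ (x : X) (n : ℕ), 0 < n → f x n - 2 * d ≤ g x n)
    (hgf : ∀ (x : X) (n : ℕ), 0 < n → g x n ≤ f x n)
    (hbd : ∀ x : X, |f x 1| ≤ c₀) (x : X) {n : ℕ} (hn : 0 < n) :
    |f x n| ≤ n * (c₀ + 2 * d) := by
  have h₁ := subadditive_cocycle_le_sum hf x one_pos hn
  have h₂ := superadditive_cocycle_sum_le hg x one_pos hn
  rw [one_mul] at h₁ h₂
  have h₃ : ∑ l ∈ Finset.range n, f (S^[1 * l] x) 1 ≤ n * (c₀ + 2 * d) := by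
    refine (Finset.sum_le_card_nsmul _ _ (c₀ + 2 * d) fun l _ => ?_).trans_eq (by rw [Finset.card_range, nsmul_eq_mul])
    linarith [(abs_le.1 (hbd (S^[1 * l] x))).2]
  have h₄ : -(n * (c₀ + 2 * d)) ≤ ∑ l ∈ Finset.range n, g (S^[1 * l] x) 1 := by
    refine Eq.trans_le (by rw [Finset.card_range, nsmul_eq_mul, mul_neg])
      (Finset.card_nsmul_le_sum _ _ (-(c₀ + 2 * d)) fun l _ => ?_)
    linarith [(abs_le.1 (hbd (S^[1 * l] x))).1, hfg (S^[1 * l] x) 1 one_pos]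
  rw [abs_le]
  constructor <;> linarith [hgf x n hn]

theorem abs_cocycle_add_sub_le (hd : 0 ≤ d)
    (hf : ∀ (x : X) (n m : ℕ), 0 < n → 0 < m → f x (n + m) ≤ f x n + f (S^[n] x) m)
    (hg : ∀ (x : X) (n m : ℕ), 0 < n → 0 < m → g x n + g (S^[n] x) m ≤ g x (n + m))
    (hfg : ∀ (x : X) (n : ℕ), 0 < n → f x n - 2 * d ≤ g x n)
    (hgf : ∀ (x : X) (n : ℕ), 0 < n → g x n ≤ f x n)
    (hbd : ∀ x : X, |f x 1| ≤ c₀) (x : X) {n : ℕ} (hn : 0 < n) (r : ℕ) :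
    |f x (n + r) - f x n| ≤ r * (c₀ + 2 * d) + 4 * d := by
  rcases Nat.eq_zero_or_pos r with rfl | hr
  · simpa using hd
  have h₁ := abs_le.1 (abs_cocycle_le hd hf hg hfg hgf hbd (S^[n] x) hr)
  have h₂ := hf x n r hn hr
  have h₃ := hg x n r hn hr
  have h₄ := hfg x n hn
  have h₅ := hfg (S^[n] x) r hr
  have h₆ := hgf x (n + r) (by omega)
  rw [abs_le]
  constructor <;> linarith [h₁.1, h₁.2]

theorem abs_block_sum_sub_cocycle_le
    (hf : ∀ (x : X) (n m : ℕ), 0 < n → 0 < m → f x (n + m) ≤ f x n + f (S^[n] x) m)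
    (hg : ∀ (x : X) (n m : ℕ), 0 < n → 0 < m → g x n + g (S^[n] x) m ≤ g x (n + m))
    (hfg : ∀ (x : X) (n : ℕ), 0 < n → f x n - 2 * d ≤ g x n)
    (hgh : ∀ (x : X) (n : ℕ), 0 < n → g x n ≤ h x n)
    (hhf : ∀ (x : X) (n : ℕ), 0 < n → h x n ≤ f x n)
    (x : X) {N n : ℕ} (hN : 0 < N) (hn : 0 < n) :
    |∑ l ∈ Finset.range n, h (S^[N * l] x) N - f x (N * n)| ≤ n * (2 * d) := by
  have h₁ := subadditive_cocycle_le_sum hf x hN hn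
  have h₂ := superadditive_cocycle_sum_le hg x hN hn
  have h₃ : ∑ l ∈ Finset.range n, f (S^[N * l] x) N - n * (2 * d) ≤
      ∑ l ∈ Finset.range n, h (S^[N * l] x) N := by
    calc _ = ∑ l ∈ Finset.range n, (f (S^[N * l] x) N - 2 * d) := by
          simp [Finset.sum_sub_distrib]
      _ ≤ _ := Finset.sum_le_sum fun l _ => (hfg _ N hN).trans (hgh _ N hN)
  have h₄ : ∑ l ∈ Finset.range n, h (S^[N * l] x) N - n * (2 * d) ≤
      ∑ l ∈ Finset.range n, g (S^[N * l] x) N := by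
    calc _ = ∑ l ∈ Finset.range n, (h (S^[N * l] x) N - 2 * d) := by
          simp [Finset.sum_sub_distrib]
      _ ≤ _ := Finset.sum_le_sum fun l _ => by
        linarith [hfg (S^[N * l] x) N hN, hhf (S^[N * l] x) N hN]
  have h₅ := (hgh x (N * n) (Nat.mul_pos hN hn)).trans (hhf x (N * n) (Nat.mul_pos hN hn))
  rw [abs_le]
  constructor <;> linarith

/-- Averages over blocks of length `N` approximate `f x m / m` up to `2 * d / N` and an error
of order `1 / m`. -/
theorem abs_block_average_sub_le (hd : 0 ≤ d) (hc₀ : 0 ≤ c₀)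
    (hf : ∀ (x : X) (n m : ℕ), 0 < n → 0 < m → f x (n + m) ≤ f x n + f (S^[n] x) m)
    (hg : ∀ (x : X) (n m : ℕ), 0 < n → 0 < m → g x n + g (S^[n] x) m ≤ g x (n + m))
    (hfg : ∀ (x : X) (n : ℕ), 0 < n → f x n - 2 * d ≤ g x n)
    (hgh : ∀ (x : X) (n : ℕ), 0 < n → g x n ≤ h x n)
    (hhf : ∀ (x : X) (n : ℕ), 0 < n → h x n ≤ f x n)
    (hbd : ∀ x : X, |f x 1| ≤ c₀) (x : X) {N m : ℕ} (hN : 0 < N) (hm : N ≤ m) :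
    |(∑ l ∈ Finset.range (m / N), h (S^[N * l] x) N) / (m / N : ℕ) / N - f x m / m| ≤
      2 * d / N + (2 * N * (c₀ + 2 * d) + 4 * d) / m := by
  have hgf : ∀ (x : X) (n : ℕ), 0 < n → g x n ≤ f x n :=
    fun x n hn => (hgh x n hn).trans (hhf x n hn)
  have hq : 0 < m / N := Nat.div_pos hm hN
  have hmod : N * (m / N) + m % N = m := Nat.div_add_mod m N
  have hr : m % N ≤ N := (Nat.mod_lt m hN).le
  have hm₀ : 0 < m := hN.trans_le hm
  generalize m / N = q at *
  generalize m % N = r at *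
  have hblock := abs_block_sum_sub_cocycle_le hf hg hfg hgh hhf x hN hq
  have hadd := abs_cocycle_add_sub_le hd hf hg hfg hgf hbd x (Nat.mul_pos hN hq) r
  have hbound := abs_cocycle_le hd hf hg hfg hgf hbd x (Nat.mul_pos hN hq)
  rw [hmod] at hadd
  generalize ∑ l ∈ Finset.range q, h (S^[N * l] x) N = s at *
  have hN' : (0 : ℝ) < N := by exact_mod_cast hN
  have hq' : (0 : ℝ) < q := by exact_mod_cast hq
  have hm' : (0 : ℝ) < m := by exact_mod_cast hm₀
  have hr' : (r : ℝ) ≤ N := by exact_mod_cast hr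
  have hmod' : (N : ℝ) * q + r = m := by exact_mod_cast hmod
  push_cast at hbound
  have hsplit : s / q / N - f x m / m = (s - f x (N * q)) / (q * N) +
      (f x (N * q) / (N * q) * r - (f x m - f x (N * q))) / m := by
    have : (r : ℝ) = m - N * q := by linarith
    rw [this]
    field_simp
    ring
  rw [hsplit]
  refine (abs_add_le _ _).trans (add_le_add ?_ ?_)
  · rw [abs_div, abs_of_pos (mul_pos hq' hN'), div_le_div_iff₀ (mul_pos hq' hN') hN']
    nlinarith
  · rw [abs_div, abs_of_pos hm']
    gcongr
    refine (abs_sub _ _).trans ?_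
    have hav : |f x (N * q) / (N * q) * r| ≤ (c₀ + 2 * d) * N := by
      rw [abs_mul, Nat.abs_cast]
      gcongr
      rw [abs_div, abs_of_pos (mul_pos hN' hq'), div_le_iff₀ (mul_pos hN' hq')]
      linarith
    have : r * (c₀ + 2 * d) ≤ N * (c₀ + 2 * d) := by gcongr
    linarith

end Cocycle

/-- Abstract form of Lemma 2.6: with `f` subadditive, `g` superadditive along the dynamics `S`,
`f - 2d ≤ g ≤ h ≤ f`, and `f(·,1)` bounded, the dyadic ergodic averages
`H_{k,n}(B) = (1/n) Σ_{l<n} h(S^{2^k l} B, 2^k)` satisfy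
`lim_k (limsup_n H_{k,n}(B))/2^k = limsup_n f(B,n)/n` and
`lim_k (liminf_n H_{k,n}(B))/2^k = liminf_n f(B,n)/n`. -/
theorem dyadic_average_mean_index {X : Type*} (S : X → X) (d c₀ : ℝ)
    (hd : 0 ≤ d) (hc₀ : 0 ≤ c₀) (f g h : X → ℕ → ℝ)
    (hf : ∀ (x : X) (n m : ℕ), 0 < n → 0 < m → f x (n + m) ≤ f x n + f (S^[n] x) m)
    (hg : ∀ (x : X) (n m : ℕ), 0 < n → 0 < m → g x n + g (S^[n] x) m ≤ g x (n + m))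
    (hfg : ∀ (x : X) (n : ℕ), 0 < n → f x n - 2 * d ≤ g x n)
    (hgh : ∀ (x : X) (n : ℕ), 0 < n → g x n ≤ h x n)
    (hhf : ∀ (x : X) (n : ℕ), 0 < n → h x n ≤ f x n)
    (hbd : ∀ x : X, |f x 1| ≤ c₀)
    (B : X)
    (H : ℕ → ℕ → ℝ)
    (hH : ∀ k n : ℕ, H k n = (∑ l ∈ Finset.range n, h (S^[2 ^ k * l] B) (2 ^ k)) / n) :
    Tendsto (fun k : ℕ => (limsup (fun n : ℕ => H k n) atTop) / 2 ^ k) atTop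
        (𝓝 (limsup (fun n : ℕ => f B n / n) atTop)) ∧
      Tendsto (fun k : ℕ => (liminf (fun n : ℕ => H k n) atTop) / 2 ^ k) atTop
        (𝓝 (liminf (fun n : ℕ => f B n / n) atTop)) := by
  have hgf : ∀ (x : X) (n : ℕ), 0 < n → g x n ≤ f x n :=
    fun x n hn => (hgh x n hn).trans (hhf x n hn)
  have ha : ∀ᶠ m : ℕ in atTop, |f B m / m| ≤ c₀ + 2 * d := by
    filter_upwards [eventually_gt_atTop 0] with m hm
    have hm' : (0 : ℝ) < m := by exact_mod_cast hm
    rw [abs_div, abs_of_pos hm', div_le_iff₀ hm', mul_comm]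
    exact abs_cocycle_le hd hf hg hfg hgf hbd B hm
  have hHb : ∀ k, ∀ᶠ n in atTop, |H k n| ≤ 2 ^ k * (c₀ + 2 * d) + 2 * d := by
    intro k
    filter_upwards [eventually_gt_atTop 0] with n hn
    have hn' : (0 : ℝ) < n := by exact_mod_cast hn
    have hN : 0 < 2 ^ k := by positivity
    have h₁ := abs_le.1 (abs_block_sum_sub_cocycle_le hf hg hfg hgh hhf B hN hn)
    have h₂ := abs_le.1 (abs_cocycle_le hd hf hg hfg hgf hbd B (Nat.mul_pos hN hn))
    push_cast at h₂
    rw [hH, abs_div, abs_of_pos hn', div_le_iff₀ hn', abs_le]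
    constructor <;> linarith [h₁.1, h₁.2, h₂.1, h₂.2]
  have key : ∀ k, ∀ᶠ m in atTop,
      |H k (m / 2 ^ k) / 2 ^ k - f B m / m| ≤ (2 * d + 1) / 2 ^ k := by
    intro k
    have hlim : Tendsto (fun m : ℕ => (2 * 2 ^ k * (c₀ + 2 * d) + 4 * d) / (m : ℝ)) atTop (𝓝 0) :=
      tendsto_const_div_atTop_nhds_zero_nat _
    have hpos : (0 : ℝ) < 1 / 2 ^ k := by positivity
    filter_upwards [eventually_ge_atTop (2 ^ k), hlim.eventually (gt_mem_nhds hpos)] with m hm hsmall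
    have hblock := abs_block_average_sub_le hd hc₀ hf hg hfg hgh hhf hbd B
      (N := 2 ^ k) (by positivity) hm
    rw [← hH] at hblock
    push_cast at hblock
    rw [add_div]
    linarith
  have hδ : Tendsto (fun k : ℕ => (2 * d + 1) / (2 : ℝ) ^ k) atTop (𝓝 0) :=
    (tendsto_pow_atTop_atTop_of_one_lt one_lt_two).const_div_atTop _
  have hdist : ∀ k, _ := fun k => abs_limsup_sub_limsup_le ha (key k)
  have hscale : ∀ k, _ := fun k =>
    limsup_comp_div_div (N := 2 ^ k) (c := (2 : ℝ) ^ k) (by positivity) (by positivity) (hHb k)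
  constructor <;> rw [tendsto_iff_norm_sub_tendsto_zero] <;>
    refine squeeze_zero (fun _ => norm_nonneg _) (fun k => ?_) hδ
  · rw [← (hscale k).1]
    exact (hdist k).1
  · rw [← (hscale k).2]
    exact (hdist k).2
end
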